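/- Let E be a real inner product space, f : E → ℝ differentiable and continuous, and γ : ℝ → E a gradient trajectory of f (γ'(t) = ∇f(γ(t)) for all t). Suppose γ(t) → p as t → −∞ and γ(t) → q as t → +∞, and that ∇f(γ(t₀)) ≠ 0 for some t₀. Then f(p) < f(q). (Along a separatrix connecting two singularities, the function value of the starting singularity is strictly smaller than that of the ending singularity; in particular the value of a saddle is bounded below by its adjacent minima and above by its adjacent maxima.) -/

import Mathlib

open Filter

/-- Along a gradient trajectory, `f` grows at rate `‖∇f‖ ^ 2`. -/
theorem hasDerivAt_comp_gradient_trajectory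
    {E : Type*} [NormedAddCommGroup E] [InnerProductSpace ℝ E] [CompleteSpace E]
    {f : E → ℝ} {γ : ℝ → E} {t : ℝ} (hf : DifferentiableAt ℝ f (γ t))
    (hγ : HasDerivAt γ (gradient f (γ t)) t) :
    HasDerivAt (fun s => f (γ s)) (‖gradient f (γ t)‖ ^ 2) t := by
  have h := hf.hasGradientAt.hasFDerivAt.comp_hasDerivAt t hγ
  rwa [InnerProductSpace.toDual_apply_apply, real_inner_self_eq_norm_sq] at h

/-- Along a separatrix of a gradient field, the function value at the starting singularity is
strictly smaller than the value at the ending singularity. -/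
theorem separatrix_strict_inequality
    {E : Type*} [NormedAddCommGroup E] [InnerProductSpace ℝ E] [CompleteSpace E]
    {f : E → ℝ} (hf : Differentiable ℝ f) (hfc : Continuous f)
    {γ : ℝ → E} (hγ : ∀ t : ℝ, HasDerivAt γ (gradient f (γ t)) t)
    {p q : E}
    (hp : Tendsto γ atBot (nhds p)) (hq : Tendsto γ atTop (nhds q))
    {t₀ : ℝ} (ht₀ : gradient f (γ t₀) ≠ 0) :
    f p < f q := by
  have hderiv : ∀ t, HasDerivAt (fun s => f (γ s)) (‖gradient f (γ t)‖ ^ 2) t :=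
    fun t => hasDerivAt_comp_gradient_trajectory (hf _) (hγ t)
  have hmono : Monotone fun s => f (γ s) :=
    monotone_of_hasDerivAt_nonneg hderiv fun t => sq_nonneg _
  have hlower : ∀ t, f p ≤ f (γ t) := hmono.le_of_tendsto ((hfc.tendsto p).comp hp)
  have hupper : ∀ t, f (γ t) ≤ f q := hmono.ge_of_tendsto ((hfc.tendsto q).comp hq)
  by_contra! hqp
  have hconst : (fun s => f (γ s)) = fun _ => f p :=
    funext fun t => le_antisymm ((hupper t).trans hqp) (hlower t)
  have hzero : ‖gradient f (γ t₀)‖ ^ 2 = 0 :=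
    (hderiv t₀).unique (hconst ▸ hasDerivAt_const t₀ (f p))
  exact ht₀ (by simpa using hzero)
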